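/- Let Λ_{K3} = U³ ⊕ E₈(−1)², the even unimodular lattice of signature (3,19). Let l ∈ Λ_{K3} be a primitive vector with ⟨l,l⟩ = 2n > 0. Then the orthogonal complement l^⊥ = {v ∈ Λ_{K3} : ⟨v,l⟩ = 0}, equipped with the restricted bilinear form, is isometric as a lattice to ℤl* ⊕ U² ⊕ E₈(−1)², where l* is a generator of the rank-one summand with ⟨l*, l*⟩ = −2n. -/

import Mathlib

noncomputable section

open scoped BigOperators

/-- Index type for the even unimodular lattice `U^a ⊕ E₈(-1)^b`. -/
abbrev LIdx (a b : ℕ) := (Fin a × Fin 2) ⊕ (Fin b × Fin 8)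

/-- Elements of the lattice `U^a ⊕ E₈(-1)^b`. -/
abbrev LVec (a b : ℕ) := LIdx a b → ℤ

/-- The Gram matrix of `U^a ⊕ E₈(-1)^b`. -/
def gramL (a b : ℕ) : LIdx a b → LIdx a b → ℤ := fun i j =>
  match i, j with
  | Sum.inl (k, s), Sum.inl (k', s') => if k = k' ∧ s ≠ s' then 1 else 0
  | Sum.inr (k, s), Sum.inr (k', s') => if k = k' then -(CartanMatrix.E₈ s s') else 0
  | _, _ => 0

/-- The bilinear form of `U^a ⊕ E₈(-1)^b`.  The K3 lattice is `Λ_{K3} = U³ ⊕ E₈(-1)²`,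
with form `BL 3 2`. -/
def BL (a b : ℕ) (x y : LVec a b) : ℤ :=
  ∑ i, ∑ j, x i * gramL a b i j * y j

/-- The Gram matrix of `ℤl* ⊕ U² ⊕ E₈(-1)²`, where `⟨l*,l*⟩ = -2n`. -/
def gramT (n : ℤ) : Unit ⊕ LIdx 2 2 → Unit ⊕ LIdx 2 2 → ℤ := fun i j =>
  match i, j with
  | Sum.inl _, Sum.inl _ => -(2 * n)
  | Sum.inr i', Sum.inr j' => gramL 2 2 i' j'
  | _, _ => 0

/-- The bilinear form of `ℤl* ⊕ U² ⊕ E₈(-1)²`. -/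
def BT (n : ℤ) (x y : Unit ⊕ LIdx 2 2 → ℤ) : ℤ :=
  ∑ i, ∑ j, x i * gramT n i j * y j

section Eichler

open LinearMap (BilinForm)

variable {V : Type*} [AddCommGroup V] (B : BilinForm ℤ V)

/-- Two vectors are equivalent if a linear automorphism preserving `B` maps one to the other. -/
def IsometricVectors (u v : V) : Prop :=
  ∃ φ : V ≃ₗ[ℤ] V, (∀ x y, B (φ x) (φ y) = B x y) ∧ φ u = v

variable {B}

theorem IsometricVectors.refl (u : V) : IsometricVectors B u u :=
  ⟨LinearEquiv.refl ℤ V, fun _ _ => rfl, rfl⟩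

theorem IsometricVectors.trans {u v w : V} (h : IsometricVectors B u v)
    (h' : IsometricVectors B v w) : IsometricVectors B u w := by
  obtain ⟨φ, hφ, rfl⟩ := h
  obtain ⟨ψ, hψ, rfl⟩ := h'
  exact ⟨φ.trans ψ, fun x y => by simp [hφ, hψ], rfl⟩

theorem IsometricVectors.neg {u v : V} (h : IsometricVectors B u v) :
    IsometricVectors B u (-v) :=
  h.trans ⟨LinearEquiv.neg ℤ, fun x y => by simp, rfl⟩

/-- The Eichler transvection attached to an isotropic vector `e` and a vector `a` orthogonal to
`e` with `B a a = 2 * c`. -/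
def eichlerMap (B : BilinForm ℤ V) (e a : V) (c : ℤ) : V →ₗ[ℤ] V :=
  LinearMap.id - (B a).smulRight e + (B e).smulRight a - c • (B e).smulRight e

theorem eichlerMap_apply (e a v : V) (c : ℤ) :
    eichlerMap B e a c v = v - B a v • e + B e v • a - (c * B e v) • e := by
  simp [eichlerMap, mul_smul, smul_comm c]

theorem eichlerMap_neg_eichlerMap (hB : ∀ x y, B x y = B y x) {e a : V} {c : ℤ}
    (he : B e e = 0) (hea : B e a = 0) (ha : B a a = 2 * c) (v : V) :
    eichlerMap B e (-a) c (eichlerMap B e a c v) = v := by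
  have hae : B a e = 0 := by rw [hB, hea]
  simp only [eichlerMap_apply, map_add, map_sub, map_smul, map_neg, LinearMap.neg_apply,
    he, hea, hae, ha]
  module

theorem isometricVectors_eichlerMap (hB : ∀ x y, B x y = B y x) {e a : V} {c : ℤ}
    (he : B e e = 0) (hea : B e a = 0) (ha : B a a = 2 * c) (v : V) :
    IsometricVectors B v (eichlerMap B e a c v) := by
  have hae : B a e = 0 := by rw [hB, hea]
  refine ⟨LinearEquiv.ofLinearMap (eichlerMap B e a c) (eichlerMap B e (-a) c) ?_ ?_, ?_, rfl⟩
  · ext v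
    have := eichlerMap_neg_eichlerMap (a := -a) (c := c) hB he (by simp [hea]) (by simp [ha]) v
    simpa using this
  · ext v
    simpa using eichlerMap_neg_eichlerMap hB he hea ha v
  · intro x y
    simp only [LinearEquiv.coe_ofLinearMap, eichlerMap_apply, map_add, map_sub, map_smul,
      LinearMap.add_apply, LinearMap.sub_apply, LinearMap.smul_apply,
      smul_eq_mul, he, hea, hae, ha, hB x e, hB x a]
    ring

/-- Two orthogonal hyperbolic planes with standard bases `e₁, f₁` and `e₂, f₂`. -/
structure IsHyperbolicPair (B : BilinForm ℤ V) (e₁ f₁ e₂ f₂ : V) : Prop where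
  symm : ∀ x y, B x y = B y x
  e₁e₁ : B e₁ e₁ = 0
  f₁f₁ : B f₁ f₁ = 0
  e₁f₁ : B e₁ f₁ = 1
  e₂e₂ : B e₂ e₂ = 0
  f₂f₂ : B f₂ f₂ = 0
  e₂f₂ : B e₂ f₂ = 1
  e₁e₂ : B e₁ e₂ = 0
  e₁f₂ : B e₁ f₂ = 0
  f₁e₂ : B f₁ e₂ = 0
  f₁f₂ : B f₁ f₂ = 0

namespace IsHyperbolicPair

variable {e₁ f₁ e₂ f₂ : V}

theorem swap (h : IsHyperbolicPair B e₁ f₁ e₂ f₂) : IsHyperbolicPair B e₁ f₁ f₂ e₂ :=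
  ⟨h.symm, h.e₁e₁, h.f₁f₁, h.e₁f₁, h.f₂f₂, h.e₂e₂, by rw [h.symm, h.e₂f₂], h.e₁f₂, h.e₁e₂,
    h.f₁f₂, h.f₁e₂⟩

theorem exists_sub_mul (h : IsHyperbolicPair B e₁ f₁ e₂ f₂) (u : V) (x : ℤ) :
    ∃ v, IsometricVectors B u v ∧ B e₁ v = B e₁ u ∧ B e₂ v = B e₂ u ∧
      B f₂ v = B f₂ u - x * B e₁ u := by
  have h₁ : B e₂ e₁ = 0 := by rw [h.symm, h.e₁e₂]
  have h₂ : B f₂ e₁ = 0 := by rw [h.symm, h.e₁f₂]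
  have h₃ : B f₂ e₂ = 1 := by rw [h.symm, h.e₂f₂]
  refine ⟨_, isometricVectors_eichlerMap (e := e₂) (a := x • e₁) (c := 0) h.symm h.e₂e₂
    (by simp [h₁]) (by simp [h.e₁e₁]) u, ?_, ?_, ?_⟩ <;>
  simp [eichlerMap_apply, h.e₁e₁, h.e₁e₂, h.e₂e₂, h₁, h₂, h₃]

theorem exists_sub (h : IsHyperbolicPair B e₁ f₁ e₂ f₂) (u : V) :
    ∃ v, IsometricVectors B u v ∧ B e₁ v = B e₁ u - B f₂ u :=
  ⟨_, isometricVectors_eichlerMap (e := f₁) (a := f₂) (c := 0) h.symm h.f₁f₁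
    h.f₁f₂ (by simp [h.f₂f₂]) u, by simp [eichlerMap_apply, h.e₁f₁, h.e₁f₂]⟩

theorem dvd_of_minimal (h : IsHyperbolicPair B e₁ f₁ e₂ f₂) {u : V} (hu : 0 < B e₁ u)
    (hmin : ∀ v, IsometricVectors B u v → 0 < B e₁ v → B e₁ u ≤ B e₁ v) :
    B e₁ u ∣ B f₂ u := by
  obtain ⟨v, huv, hv, -, hv'⟩ := h.exists_sub_mul u (B f₂ u / B e₁ u)
  obtain ⟨w, hvw, hw⟩ := h.exists_sub v
  have hmod : B f₂ v = B f₂ u % B e₁ u := by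
    rw [hv', Int.emod_def, mul_comm]
  have hlt := Int.emod_lt_of_pos (B f₂ u) hu
  have hnonneg := Int.emod_nonneg (B f₂ u) hu.ne'
  have := hmin w (huv.trans hvw) (by omega)
  exact Int.dvd_of_emod_eq_zero (by omega)

theorem dvd_of_forall_dvd (h : IsHyperbolicPair B e₁ f₁ e₂ f₂) (heven : ∀ x, Even (B x x))
    {l : V} (hdvd : ∀ u, IsometricVectors B l u → B e₁ u = B e₁ l →
      B e₁ l ∣ B f₂ u ∧ B e₁ l ∣ B e₂ u) (w : V) : B e₁ l ∣ B l w := by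
  obtain ⟨x, hx⟩ := (hdvd l (.refl l) rfl).1
  obtain ⟨u, hlu, hu₁, hu₂, hu₃⟩ := h.exists_sub_mul l x
  obtain ⟨y, hy⟩ := (hdvd u hlu hu₁).2
  obtain ⟨v, huv, hv₁, hv₂, hv₃⟩ := h.swap.exists_sub_mul u y
  replace hv₂ : B f₂ v = 0 := by rw [hv₂, hu₃, hx]; ring
  replace hv₃ : B e₂ v = 0 := by rw [hv₃, hy, hu₁]; ring
  replace hv₁ := hv₁.trans hu₁
  have hlv := hlu.trans huv
  obtain ⟨φ, hφ, hφv⟩ := id hlv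
  have h₃ : B f₂ e₂ = 1 := by rw [h.symm, h.e₂f₂]
  set a : V := φ w - B f₂ (φ w) • e₂ - B e₂ (φ w) • f₂ with ha
  have he₂a : B e₂ a = 0 := by simp [ha, h.e₂e₂, h.e₂f₂]
  have hf₂a : B f₂ a = 0 := by simp [ha, h.f₂f₂, h₃]
  have hav : B a v = B l w := by
    rw [h.symm, ← hφ l w, hφv]
    simp [ha, h.symm v e₂, h.symm v f₂, hv₂, hv₃]
  obtain ⟨c, hc⟩ := heven a
  have key := hdvd _ (hlv.trans (isometricVectors_eichlerMap (e := e₂) (a := a) (c := c) h.symm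
    h.e₂e₂ he₂a (by rw [hc, two_mul]) v))
    (by simp [eichlerMap_apply, hv₃, hv₁, h.e₁e₂])
  simpa [eichlerMap_apply, hv₃, hv₂, h₃, hav] using key.1

theorem exists_ne_zero (h : IsHyperbolicPair B e₁ f₁ e₂ f₂) (heven : ∀ x, Even (B x x))
    {l w : V} (hlw : B l w ≠ 0) : ∃ u, IsometricVectors B l u ∧ B e₁ u ≠ 0 := by
  by_contra! hzero
  have key : ∀ {e₂ f₂}, IsHyperbolicPair B e₁ f₁ e₂ f₂ → ∀ u, IsometricVectors B l u →
      B f₂ u = 0 := fun h u hu => by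
    obtain ⟨v, huv, hv⟩ := h.exists_sub u
    have := hzero v (hu.trans huv)
    have := hzero u hu
    omega
  have := h.dvd_of_forall_dvd heven (l := l)
    (fun u hu _ => by simp [key h u hu, key h.swap u hu]) w
  rw [hzero l (.refl l), zero_dvd_iff] at this
  exact hlw this

theorem exists_eq_one (h : IsHyperbolicPair B e₁ f₁ e₂ f₂) (heven : ∀ x, Even (B x x))
    {l w : V} (hlw : B l w = 1) : ∃ u, IsometricVectors B l u ∧ B e₁ u = 1 := by
  classical
  have hex : ∃ k : ℕ, 0 < k ∧ ∃ u, IsometricVectors B l u ∧ B e₁ u = k := by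
    obtain ⟨u, hu, hne⟩ := h.exists_ne_zero heven (hlw.trans_ne one_ne_zero)
    refine ⟨(B e₁ u).natAbs, Int.natAbs_pos.mpr hne, ?_⟩
    rcases Int.natAbs_eq (B e₁ u) with hpos | hneg
    · exact ⟨u, hu, hpos⟩
    · exact ⟨-u, hu.neg, by rw [map_neg]; omega⟩
  obtain ⟨hpos, u, hlu, hu⟩ := Nat.find_spec hex
  have hmin : ∀ v, IsometricVectors B l v → 0 < B e₁ v → B e₁ u ≤ B e₁ v := fun v hv hv' => by
    have := Nat.find_min' hex (m := (B e₁ v).toNat) ⟨by omega, v, hv, by omega⟩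
    omega
  refine ⟨u, hlu, ?_⟩
  have hdvd := h.dvd_of_forall_dvd heven (l := u) fun v hv hvu => by
    rw [← hvu]
    have hv' : ∀ x, IsometricVectors B v x → 0 < B e₁ x → B e₁ v ≤ B e₁ x := fun x hx hx' =>
      hvu ▸ hmin x (hlu.trans (hv.trans hx)) hx'
    exact ⟨h.dvd_of_minimal (by omega) hv', h.swap.dvd_of_minimal (by omega) hv'⟩
  obtain ⟨φ, hφ, rfl⟩ := hlu
  have := hdvd (φ w)
  rw [hφ, hlw] at this
  exact Int.eq_one_of_dvd_one (by omega) this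

/-- Eichler's criterion for vectors of divisibility one. -/
theorem isometricVectors_of_apply_eq_one (h : IsHyperbolicPair B e₁ f₁ e₂ f₂)
    (heven : ∀ x, Even (B x x)) {l w : V} {n : ℤ} (hlw : B l w = 1) (hl : B l l = 2 * n) :
    IsometricVectors B l (f₁ + n • e₁) := by
  obtain ⟨u, hlu, hu⟩ := h.exists_eq_one heven hlw
  set a : V := f₁ + B f₁ u • e₁ - u with ha
  have hf₁e₁ : B f₁ e₁ = 1 := by rw [h.symm, h.e₁f₁]
  have he₁a : B e₁ a = 0 := by simp [ha, h.e₁f₁, h.e₁e₁, hu]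
  obtain ⟨c, hc⟩ := heven a
  have hlv := hlu.trans (isometricVectors_eichlerMap (e := e₁) (a := a) (c := c) h.symm
    h.e₁e₁ he₁a (by rw [hc, two_mul]) u)
  have heq : eichlerMap B e₁ a c u = f₁ + (B f₁ u - B a u - c) • e₁ := by
    rw [eichlerMap_apply, hu, one_smul, ha]
    module
  rw [heq] at hlv
  convert hlv using 3
  obtain ⟨φ, hφ, hφl⟩ := hlv
  have hnorm := hφ l l
  rw [hφl, hl] at hnorm
  simp [h.f₁f₁, h.e₁e₁, h.e₁f₁, hf₁e₁] at hnorm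
  omega

end IsHyperbolicPair

end Eichler

section Lattice

open Matrix

theorem BL_eq (a b : ℕ) (x y : LVec a b) :
    BL a b x y = ∑ k, (x (.inl (k, 0)) * y (.inl (k, 1)) + x (.inl (k, 1)) * y (.inl (k, 0))) -
      ∑ k, (fun s => x (.inr (k, s))) ⬝ᵥ CartanMatrix.E₈ *ᵥ fun s => y (.inr (k, s)) := by
  simp only [BL, gramL, Fintype.sum_sum_type, Fintype.sum_prod_type, Fin.sum_univ_two,
    dotProduct, mulVec, Finset.mul_sum]
  simp [Finset.sum_add_distrib, ← Finset.sum_neg_distrib, mul_assoc, sub_eq_add_neg]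

/-- The form `BL` as a bundled bilinear form. -/
def formL (a b : ℕ) : LinearMap.BilinForm ℤ (LVec a b) :=
  Matrix.toBilin' (Matrix.of (gramL a b))

theorem formL_apply (a b : ℕ) (x y : LVec a b) : formL a b x y = BL a b x y := by
  simp [formL, BL, Matrix.toBilin'_apply]

theorem BL_comm (a b : ℕ) (x y : LVec a b) : BL a b x y = BL a b y x := by
  have hE (u v : Fin 8 → ℤ) : u ⬝ᵥ CartanMatrix.E₈ *ᵥ v = v ⬝ᵥ CartanMatrix.E₈ *ᵥ u := by
    rw [dotProduct_mulVec, ← mulVec_transpose, CartanMatrix.E₈_transpose, dotProduct_comm]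
  simp only [BL_eq, hE (fun s => x (.inr (_, s)))]
  congr 1
  exact Finset.sum_congr rfl fun k _ => by ring

theorem even_E₈ (u : Fin 8 → ℤ) : Even (u ⬝ᵥ CartanMatrix.E₈ *ᵥ u) := by
  refine ⟨u 0 ^ 2 + u 1 ^ 2 + u 2 ^ 2 + u 3 ^ 2 + u 4 ^ 2 + u 5 ^ 2 + u 6 ^ 2 + u 7 ^ 2 -
    u 0 * u 2 - u 1 * u 3 - u 2 * u 3 - u 3 * u 4 - u 4 * u 5 - u 5 * u 6 - u 6 * u 7, ?_⟩
  simp [dotProduct, mulVec, CartanMatrix.E₈, Fin.sum_univ_eight]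
  ring

theorem even_BL_self (a b : ℕ) (x : LVec a b) : Even (BL a b x x) := by
  rw [BL_eq]
  exact (Finset.even_sum _ fun k _ => ⟨_, by rw [mul_comm]⟩).sub
    (Finset.even_sum _ fun k _ => even_E₈ _)

theorem BL_single_inl_zero (a b : ℕ) (k : Fin a) (x : LVec a b) :
    BL a b (Pi.single (.inl (k, 0)) 1) x = x (.inl (k, 1)) := by
  simp [BL_eq, Pi.single_apply, dotProduct]

theorem BL_single_inl_one (a b : ℕ) (k : Fin a) (x : LVec a b) :
    BL a b (Pi.single (.inl (k, 1)) 1) x = x (.inl (k, 0)) := by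
  simp [BL_eq, Pi.single_apply, dotProduct]

theorem BL_single_inr (a b : ℕ) (k : Fin b) (s : Fin 8) (x : LVec a b) :
    BL a b (Pi.single (.inr (k, s)) 1) x =
      -(CartanMatrix.E₈ *ᵥ fun s => x (.inr (k, s))) s := by
  simp [BL_eq, Pi.single_apply, dotProduct, ite_and]

/-- Unimodularity of `BL`: an integer dividing all pairings with `l` divides `l`. -/
theorem dvd_of_forall_dvd_BL (a b : ℕ) {l : LVec a b} {d : ℤ} (h : ∀ x, d ∣ BL a b x l)
    (i : LIdx a b) : d ∣ l i := by
  rcases i with ⟨k, s⟩ | ⟨k, s⟩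
  · fin_cases s
    · simpa [BL_single_inl_one] using h (Pi.single (.inl (k, 1)) 1)
    · simpa [BL_single_inl_zero] using h (Pi.single (.inl (k, 0)) 1)
  · have hinv : CartanMatrix.E₈.adjugate *ᵥ CartanMatrix.E₈ *ᵥ (fun s => l (.inr (k, s))) =
        fun s => l (.inr (k, s)) := by
      rw [mulVec_mulVec, adjugate_mul, CartanMatrix.E₈_det, one_smul, one_mulVec]
    rw [← congrFun hinv s, mulVec, dotProduct]
    refine Finset.dvd_sum fun t _ => Dvd.dvd.mul_left ?_ _
    simpa [BL_single_inr] using h (Pi.single (.inr (k, t)) 1)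

theorem exists_BL_eq_one (a b : ℕ) {l : LVec a b}
    (hprim : ∀ (k : ℤ) (w : LVec a b), l = k • w → IsUnit k) : ∃ w, BL a b l w = 1 := by
  obtain ⟨d, hd⟩ := IsPrincipalIdealRing.principal (LinearMap.range (formL a b l))
  have hdvd (i : LIdx a b) : d ∣ l i := dvd_of_forall_dvd_BL a b (fun x => by
    have hx : formL a b l x ∈ LinearMap.range (formL a b l) := ⟨x, rfl⟩
    rwa [hd, Ideal.submodule_span_eq, Ideal.mem_span_singleton, formL_apply, BL_comm] at hx) i
  choose w hw using hdvd
  have hunit := hprim d w (funext hw)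
  have hone : (1 : ℤ) ∈ LinearMap.range (formL a b l) := by
    rw [hd, Ideal.submodule_span_eq, Ideal.mem_span_singleton]
    exact hunit.dvd
  obtain ⟨x, hx⟩ := hone
  exact ⟨x, by rwa [formL_apply] at hx⟩

theorem isHyperbolicPair_formL : IsHyperbolicPair (formL 3 2)
    (Pi.single (.inl (0, 0)) 1) (Pi.single (.inl (0, 1)) 1)
    (Pi.single (.inl (1, 0)) 1) (Pi.single (.inl (1, 1)) 1) := by
  constructor <;> simp [formL_apply, BL_single_inl_zero, BL_single_inl_one]
  exact BL_comm 3 2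

/-- The embedding of `ℤl* ⊕ U² ⊕ E₈(-1)²` into the K3 lattice which sends `l*` to `f - n e`, where
`e, f` is the standard basis of the first hyperbolic plane. -/
def complementMap (n : ℤ) : (Unit ⊕ LIdx 2 2 → ℤ) →ₗ[ℤ] LVec 3 2 where
  toFun x
    | .inl (k, s) => Fin.cases (if s = 0 then -n * x (.inl ()) else x (.inl ()))
        (fun k' => x (.inr (.inl (k', s)))) k
    | .inr i => x (.inr (.inr i))
  map_add' x y := by
    ext (⟨k, s⟩ | i)
    · cases k using Fin.cases
      · by_cases hs : s = 0 <;> simp [hs, mul_add]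
      · simp
    · simp
  map_smul' c x := by
    ext (⟨k, s⟩ | i)
    · cases k using Fin.cases
      · by_cases hs : s = 0 <;> simp [hs, mul_left_comm]
      · simp
    · simp

theorem BT_eq (n : ℤ) (x y : Unit ⊕ LIdx 2 2 → ℤ) :
    BT n x y = -(2 * n) * (x (.inl ()) * y (.inl ())) +
      BL 2 2 (fun i => x (.inr i)) (fun i => y (.inr i)) := by
  rw [BT, Fintype.sum_sum_type]
  simp only [Fintype.sum_sum_type (α₁ := Unit), gramT, BL]
  simp
  ring

theorem BL_complementMap (n : ℤ) (x y : Unit ⊕ LIdx 2 2 → ℤ) :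
    BL 3 2 (complementMap n x) (complementMap n y) = BT n x y := by
  rw [BT_eq, BL_eq, BL_eq, Fin.sum_univ_succ]
  simp [complementMap]
  ring

theorem complementMap_injective (n : ℤ) : Function.Injective (complementMap n) := by
  intro x y hxy
  ext (_ | ⟨k, s⟩ | i)
  · simpa [complementMap] using congrFun hxy (.inl (0, 1))
  · simpa [complementMap] using congrFun hxy (.inl (k.succ, s))
  · simpa [complementMap] using congrFun hxy (.inr i)

theorem range_complementMap (n : ℤ) : Set.range (complementMap n) =
    {v | BL 3 2 v (Pi.single (.inl (0, 1)) 1 + n • Pi.single (.inl (0, 0)) 1) = 0} := by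
  have hBL (v : LVec 3 2) : BL 3 2 v (Pi.single (.inl (0, 1)) 1 + n • Pi.single (.inl (0, 0)) 1) =
      v (.inl (0, 0)) + n * v (.inl (0, 1)) := by
    rw [← formL_apply, map_add, map_smul, formL_apply, formL_apply, BL_comm, BL_single_inl_one,
      BL_comm, BL_single_inl_zero, smul_eq_mul]
  ext v
  rw [Set.mem_ofPred_eq, hBL]
  constructor
  · rintro ⟨x, rfl⟩
    simp [complementMap]
  · intro hv
    refine ⟨Sum.elim (fun _ => v (.inl (0, 1))) (Sum.elim (fun p => v (.inl (p.1.succ, p.2)))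
      fun p => v (.inr p)), ?_⟩
    ext (⟨k, s⟩ | i)
    · cases k using Fin.cases
      · fin_cases s
        · simp [complementMap]
          linarith
        · simp [complementMap]
      · simp [complementMap]
    · simp [complementMap]

end Lattice

/-- If `l` is a primitive vector of the K3 lattice `Λ_{K3} = U³ ⊕ E₈(-1)²` with
`⟨l,l⟩ = 2n > 0`, then the orthogonal complement `l^⊥`, with the restricted form, is
isometric to `ℤl* ⊕ U² ⊕ E₈(-1)²` with `⟨l*,l*⟩ = -2n`: there is an injective ℤ-linear map
from the latter lattice onto `{v : ⟨v,l⟩ = 0}` preserving the bilinear forms. -/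
theorem statement14 (n : ℤ) (hn : 0 < n) (l : LVec 3 2)
    (hprim : ∀ (k : ℤ) (w : LVec 3 2), l = k • w → IsUnit k)
    (hl : BL 3 2 l l = 2 * n) :
    ∃ g : (Unit ⊕ LIdx 2 2 → ℤ) →ₗ[ℤ] LVec 3 2,
      Function.Injective g ∧
      Set.range g = {v : LVec 3 2 | BL 3 2 v l = 0} ∧
      ∀ x y, BL 3 2 (g x) (g y) = BT n x y := by
  
  obtain ⟨w, hw⟩ := exists_BL_eq_one 3 2 hprim
  obtain ⟨φ, hφ, hφl⟩ := isHyperbolicPair_formL.isometricVectors_of_apply_eq_one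
    (fun x => by rw [formL_apply]; exact even_BL_self 3 2 x)
    (l := l) (w := w) (n := n) (by rw [formL_apply, hw]) (by rw [formL_apply, hl])
  simp only [formL_apply] at hφ
  have hsymm (x y : LVec 3 2) : BL 3 2 (φ.symm x) (φ.symm y) = BL 3 2 x y := by
    rw [← hφ, φ.apply_symm_apply, φ.apply_symm_apply]
  refine ⟨φ.symm.toLinearMap ∘ₗ complementMap n,
    φ.symm.injective.comp (complementMap_injective n), ?_, fun x y => ?_⟩
  · rw [LinearMap.coe_comp, Set.range_comp, range_complementMap, ← hφl]
    ext v
    simp only [LinearEquiv.coe_coe, Set.mem_image, Set.mem_ofPred_eq]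
    constructor
    · rintro ⟨u, hu, rfl⟩
      rwa [← hφ, φ.apply_symm_apply]
    · exact fun hv => ⟨φ v, by rwa [hφ], φ.symm_apply_apply v⟩
  · rw [← BL_complementMap]
    exact hsymm _ _
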